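/- Let p be a prime, {a¹,…,aⁿ} ⊆ ℤ^m, and C := cone{a¹,…,aⁿ}. Then {a¹,…,aⁿ} is a p-adic generating set for a cone if, and only if, for every nonempty face F of C, the set {aⁱ : aⁱ ∈ F} is a p-adic generating set for a subspace. -/

import Mathlib

open Finset

attribute [local instance] Classical.propDecidable

/-- A real number is `p`-adic if it has the form `a / p^k` for integers `a, k`, `k ≥ 0`. -/
def IsPadic (p : ℕ) (r : ℝ) : Prop := ∃ (a : ℤ) (k : ℕ), r = (a : ℝ) / (p : ℝ) ^ k

/-- A finite family of integral vectors is a `p`-adic generating set for a cone if every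
integral vector in its conic hull is a conic combination of the vectors with `p`-adic
coefficients. -/
def IsPGSC (p : ℕ) {ι d : Type} [Fintype ι] [Fintype d] (a : ι → d → ℤ) : Prop :=
  ∀ w : d → ℤ,
    (∃ lam : ι → ℝ, (∀ i, 0 ≤ lam i) ∧ ∀ j, ∑ i, lam i * (a i j : ℝ) = (w j : ℝ)) →
    ∃ lam : ι → ℝ, (∀ i, 0 ≤ lam i) ∧ (∀ i, IsPadic p (lam i)) ∧
      ∀ j, ∑ i, lam i * (a i j : ℝ) = (w j : ℝ)

/-- A finite family of integral vectors is a `p`-adic generating set for a subspace if every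
integral vector in its linear hull is a linear combination of the vectors with `p`-adic
coefficients. -/
def IsPGSS (p : ℕ) {ι d : Type} [Fintype ι] [Fintype d] (a : ι → d → ℤ) : Prop :=
  ∀ w : d → ℤ,
    (∃ lam : ι → ℝ, ∀ j, ∑ i, lam i * (a i j : ℝ) = (w j : ℝ)) →
    ∃ lam : ι → ℝ, (∀ i, IsPadic p (lam i)) ∧
      ∀ j, ∑ i, lam i * (a i j : ℝ) = (w j : ℝ)

/-- `F` is a face of `P`: the intersection of `P` with a supporting hyperplane (this includes
`P` itself, via `c = 0, δ = 0`). -/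
def IsFace {d : Type} [Fintype d] (P F : Set (d → ℝ)) : Prop :=
  ∃ (c : d → ℝ) (δ : ℝ), (∀ x ∈ P, ∑ j, c j * x j ≤ δ) ∧
    F = {x ∈ P | ∑ j, c j * x j = δ}

/-- `y` is feasible for the dual LP `min {bᵀy : Aᵀy = w, y ≥ 0}`. -/
def DualFeasible {m n : ℕ} (A : Matrix (Fin m) (Fin n) ℤ) (w : Fin n → ℤ)
    (y : Fin m → ℝ) : Prop :=
  (∀ i, 0 ≤ y i) ∧ ∀ j, ∑ i, y i * (A i j : ℝ) = (w j : ℝ)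

/-- `y` is an optimal solution of the dual LP `min {bᵀy : Aᵀy = w, y ≥ 0}`. -/
def DualOptimal {m n : ℕ} (A : Matrix (Fin m) (Fin n) ℤ) (b : Fin m → ℤ) (w : Fin n → ℤ)
    (y : Fin m → ℝ) : Prop :=
  DualFeasible A w y ∧
    ∀ y', DualFeasible A w y' → ∑ i, (b i : ℝ) * y i ≤ ∑ i, (b i : ℝ) * y' i

/-- The system `Ax ≤ b` is totally dual `p`-adic. -/
def TotallyDualPadic (p : ℕ) {m n : ℕ} (A : Matrix (Fin m) (Fin n) ℤ) (b : Fin m → ℤ) : Prop :=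
  ∀ w : Fin n → ℤ, (∃ y, DualOptimal A b w y) →
    ∃ y, DualOptimal A b w y ∧ ∀ i, IsPadic p (y i)

lemma farkas_fun {V : Type} [AddCommGroup V] [Module ℝ V] :
    ∀ (k : ℕ) (g : Fin k → V →ₗ[ℝ] ℝ) (b : V →ₗ[ℝ] ℝ),
      (∀ x, (∀ i, g i x ≤ 0) → b x ≤ 0) →
      ∃ u : Fin k → ℝ, (∀ i, 0 ≤ u i) ∧ ∀ x, b x = ∑ i, u i * g i x := by
  intro k
  induction k with
  | zero =>
    intro g b h
    refine ⟨fun _ => 0, fun i => le_rfl, fun x => ?_⟩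
    have h1 := h x (fun i => i.elim0)
    have h2 := h (-x) (fun i => i.elim0)
    simp only [map_neg] at h2
    simp
    linarith
  | succ k ih =>
    intro g b h
    by_cases hb : ∀ x, (∀ i : Fin k, g i.succ x ≤ 0) → b x ≤ 0
    · obtain ⟨u, hu, hux⟩ := ih (fun i => g i.succ) b hb
      refine ⟨Fin.cons 0 u, fun i => ?_, fun x => ?_⟩
      · refine Fin.cases ?_ (fun i => ?_) i
        · simp
        · simpa using hu i
      · rw [Fin.sum_univ_succ]
        simpa using hux x
    · push Not at hb
      obtain ⟨x0, hx0, hbx0⟩ := hb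
      have hg0 : 0 < g 0 x0 := by
        by_contra hcon
        push Not at hcon
        have := h x0 (fun i => Fin.cases hcon hx0 i)
        linarith
      obtain ⟨y, hy1, hy2, hy3⟩ : ∃ y, g 0 y = 1 ∧ (∀ i : Fin k, g i.succ y ≤ 0) ∧ 0 < b y := by
        refine ⟨(g 0 x0)⁻¹ • x0, ?_, fun i => ?_, ?_⟩
        · simp [hg0.ne']
        · have := mul_nonpos_of_nonneg_of_nonpos (inv_nonneg.2 hg0.le) (hx0 i)
          simpa using this
        · have := mul_pos (inv_pos.2 hg0) hbx0
          simpa using this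
      obtain ⟨u, hu, hux⟩ := ih (fun i => g i.succ - g i.succ y • g 0) (b - b y • g 0) (by
        intro x hx
        have := h (x - g 0 x • y) (fun i => by
          refine Fin.cases ?_ (fun i => ?_) i
          · simp [hy1]
          · have := hx i
            simp only [LinearMap.sub_apply, LinearMap.smul_apply, smul_eq_mul] at this
            simp only [map_sub, map_smul, smul_eq_mul]
            linarith)
        simp only [LinearMap.sub_apply, LinearMap.smul_apply, smul_eq_mul]
        simp only [map_sub, map_smul, smul_eq_mul] at this
        linarith)
      refine ⟨Fin.cons (b y - ∑ i, u i * g i.succ y) u, fun i => ?_, fun x => ?_⟩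
      · refine Fin.cases ?_ (fun i => ?_) i
        · have : ∑ i, u i * g i.succ y ≤ 0 :=
            Finset.sum_nonpos fun i _ => mul_nonpos_of_nonneg_of_nonpos (hu i) (hy2 i)
          simp only [Fin.cons_zero]
          linarith
        · simpa using hu i
      · rw [Fin.sum_univ_succ]
        have := hux x
        simp only [LinearMap.sub_apply, LinearMap.smul_apply, smul_eq_mul, mul_sub,
          Finset.sum_sub_distrib, ← mul_assoc, ← Finset.sum_mul] at this
        simp only [Fin.cons_zero, Fin.cons_succ]
        linarith

lemma farkas_vec {m k : ℕ} (g : Fin k → Fin m → ℝ) (b : Fin m → ℝ)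
    (h : ∀ c : Fin m → ℝ, (∀ i, ∑ j, c j * g i j ≤ 0) → ∑ j, c j * b j ≤ 0) :
    ∃ u : Fin k → ℝ, (∀ i, 0 ≤ u i) ∧ ∀ j, b j = ∑ i, u i * g i j := by
  obtain ⟨u, hu, hux⟩ := farkas_fun k (fun i => Fintype.linearCombination ℝ (g i))
    (Fintype.linearCombination ℝ b) (by
      intro x hx
      simpa [Fintype.linearCombination_apply] using
        h x (fun i => by simpa [Fintype.linearCombination_apply] using hx i))
  refine ⟨u, hu, fun j => ?_⟩
  have := hux (Pi.single j 1)
  simpa [Fintype.linearCombination_apply_single] using this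

lemma dot_comb {m n : ℕ} (g : Fin n → Fin m → ℝ) (c : Fin m → ℝ) (u : Fin n → ℝ) :
    ∑ j, c j * ∑ i, u i * g i j = ∑ i, u i * ∑ j, c j * g i j := by
  simp only [Finset.mul_sum]
  rw [Finset.sum_comm]
  exact Finset.sum_congr rfl fun i _ => Finset.sum_congr rfl fun j _ => by ring

/-- One-coordinate strict complementarity. -/
lemma compl_one {m n : ℕ} (g : Fin n → Fin m → ℝ) (w : Fin m → ℝ) (lam : Fin n → ℝ)
    (hlam : ∀ i, 0 ≤ lam i) (hw : ∀ j, w j = ∑ i, lam i * g i j) (i : Fin n) :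
    ∃ (l : Fin n → ℝ) (c : Fin m → ℝ), (∀ k, 0 ≤ l k) ∧ (∀ j, w j = ∑ k, l k * g k j) ∧
      (∀ k, ∑ j, c j * g k j ≤ 0) ∧ ∑ j, c j * w j = 0 ∧ (0 < l i ∨ ∑ j, c j * g i j < 0) := by
  by_cases hc : ∃ c : Fin m → ℝ, (∀ k, ∑ j, c j * g k j ≤ 0) ∧ ∑ j, c j * w j = 0 ∧
      ∑ j, c j * g i j < 0
  · obtain ⟨c, h1, h2, h3⟩ := hc
    exact ⟨lam, c, hlam, hw, h1, h2, Or.inr h3⟩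
  · push Not at hc
    obtain ⟨u, hu, hux⟩ := farkas_vec (Fin.cons (-w) g : Fin (n+1) → Fin m → ℝ) (-(g i)) (by
      intro c h
      have h0 := h 0
      have hs : ∀ k, ∑ j, c j * g k j ≤ 0 := fun k => by simpa using h k.succ
      simp at h0
      have hle : ∑ j, c j * w j ≤ 0 := by
        simp only [hw]
        rw [dot_comb]
        exact Finset.sum_nonpos fun k _ => mul_nonpos_of_nonneg_of_nonpos (hlam k) (hs k)
      have := hc c hs (le_antisymm hle h0)
      simpa using this)
    set t := u 0 with ht
    have ht0 : 0 ≤ t := hu 0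
    have key : ∀ j, ∑ k, (lam k + u k.succ + if k = i then 1 else 0) * g k j = (1 + t) * w j := by
      intro j
      have := hux j
      rw [Fin.sum_univ_succ] at this
      simp only [Pi.neg_apply, Fin.cons_zero, Fin.cons_succ] at this
      simp only [add_mul, Finset.sum_add_distrib, ← hw, ite_mul, one_mul, zero_mul,
        Finset.sum_ite_eq', Finset.mem_univ, if_true]
      linarith
    refine ⟨fun k => (1 + t)⁻¹ * (lam k + u k.succ + if k = i then 1 else 0), 0,
      fun k => ?_, fun j => ?_, by simp, by simp, Or.inl ?_⟩
    · have := hlam k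
      have := hu k.succ
      dsimp only
      split_ifs <;> positivity
    · simp only [mul_assoc, ← Finset.mul_sum]
      rw [key, ← mul_assoc, inv_mul_cancel₀ (by positivity), one_mul]
    · have := hlam i
      have := hu i.succ
      simp only [if_true]
      positivity

lemma compl_all {m n : ℕ} (g : Fin n → Fin m → ℝ) (w : Fin m → ℝ) (lam : Fin n → ℝ)
    (hlam : ∀ i, 0 ≤ lam i) (hw : ∀ j, w j = ∑ i, lam i * g i j) :
    ∃ (l : Fin n → ℝ) (c : Fin m → ℝ), (∀ k, 0 ≤ l k) ∧ (∀ j, w j = ∑ k, l k * g k j) ∧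
      (∀ k, ∑ j, c j * g k j ≤ 0) ∧ ∑ j, c j * w j = 0 ∧
      ∀ i, (0 < l i ∨ ∑ j, c j * g i j < 0) := by
  choose l c h1 h2 h3 h4 h5 using compl_one g w lam hlam hw
  have hcs : ∀ x : Fin m → ℝ, ∑ j, (∑ i, c i j) * x j = ∑ i, ∑ j, c i j * x j := by
    intro x
    simp only [Finset.sum_mul]
    rw [Finset.sum_comm]
  have hn : (0:ℝ) < (n:ℝ) + 1 := by positivity
  refine ⟨fun k => ((n:ℝ) + 1)⁻¹ * (lam k + ∑ i, l i k), fun j => ∑ i, c i j,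
    fun k => ?_, fun j => ?_, fun k => ?_, ?_, fun i => ?_⟩
  · exact mul_nonneg (inv_nonneg.2 hn.le)
      (add_nonneg (hlam k) (Finset.sum_nonneg fun i _ => h1 i k))
  · have : ∑ k, (lam k + ∑ i, l i k) * g k j = ((n:ℝ) + 1) * w j := by
      simp only [add_mul, Finset.sum_add_distrib, ← hw, Finset.sum_mul]
      rw [Finset.sum_comm]
      simp only [← h2]
      simp
      ring
    simp only [mul_assoc, ← Finset.mul_sum]
    rw [this, ← mul_assoc, inv_mul_cancel₀ hn.ne', one_mul]
  · rw [hcs]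
    exact Finset.sum_nonpos fun i _ => h3 i k
  · rw [hcs]
    exact Finset.sum_eq_zero fun i _ => h4 i
  · rcases h5 i with h | h
    · left
      refine mul_pos (inv_pos.2 hn) (add_pos_of_nonneg_of_pos (hlam i) ?_)
      exact Finset.sum_pos' (fun k _ => h1 k i) ⟨i, Finset.mem_univ _, h⟩
    · right
      rw [hcs]
      exact Finset.sum_neg' (fun k _ => h3 k i) ⟨i, Finset.mem_univ _, h⟩

/-- Every real vector is a real combination of integral vectors satisfying all
integral relations of the original vector. -/
lemma int_decomp {n : ℕ} (v : Fin n → ℝ) :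
    ∃ (k : ℕ) (r : Fin k → ℝ) (z : Fin k → Fin n → ℤ), (∀ i, v i = ∑ l, r l * (z l i : ℝ)) ∧
      ∀ q : Fin n → ℤ, ∑ i, (q i : ℝ) * v i = 0 → ∀ l, ∑ i, q i * z l i = 0 := by
  let M := Submodule.span ℤ (Set.range v)
  have : Module.Finite ℤ M := Module.Finite.span_of_finite ℤ (Set.finite_range v)
  let b := Module.finBasis ℤ M
  let v' : Fin n → M := fun i => ⟨v i, Submodule.subset_span ⟨i, rfl⟩⟩
  refine ⟨_, fun l => (b l : ℝ), fun l i => b.repr (v' i) l, fun i => ?_, fun q hq l => ?_⟩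
  · have := congrArg (Subtype.val) (b.sum_repr (v' i))
    simp only [Submodule.coe_sum, Submodule.coe_smul, zsmul_eq_mul] at this
    rw [show v i = (v' i : ℝ) from rfl, ← this]
    exact Finset.sum_congr rfl fun l _ => mul_comm _ _
  · have h0 : ∑ i, q i • v' i = 0 := by
      apply Subtype.ext
      simpa [v'] using hq
    have := congrArg (fun x => b.repr x l) h0
    simpa using this

lemma isPadic_int (p : ℕ) (a : ℤ) : IsPadic p (a : ℝ) := ⟨a, 0, by simp⟩

lemma isPadic_add {p : ℕ} (hp : p.Prime) {x y : ℝ} (hx : IsPadic p x) (hy : IsPadic p y) :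
    IsPadic p (x + y) := by
  obtain ⟨a, k, rfl⟩ := hx
  obtain ⟨b, l, rfl⟩ := hy
  have : (p:ℝ) ≠ 0 := by exact_mod_cast hp.ne_zero
  refine ⟨a * p ^ l + b * p ^ k, k + l, ?_⟩
  push_cast
  rw [div_add_div _ _ (pow_ne_zero _ this) (pow_ne_zero _ this), pow_add]
  ring

lemma isPadic_mul_int {p : ℕ} {x : ℝ} (hx : IsPadic p x) (z : ℤ) :
    IsPadic p (x * z) := by
  obtain ⟨a, k, rfl⟩ := hx
  refine ⟨a * z, k, ?_⟩
  push_cast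
  ring

lemma isPadic_sum {p : ℕ} (hp : p.Prime) {ι : Type} (s : Finset ι) (f : ι → ℝ)
    (h : ∀ i, IsPadic p (f i)) : IsPadic p (∑ i ∈ s, f i) := by
  induction s using Finset.induction_on with
  | empty => simpa using isPadic_int p 0
  | insert i s hi ih =>
    rw [Finset.sum_insert hi]
    exact isPadic_add hp (h i) ih

lemma floor_tendsto {p : ℕ} (hp : p.Prime) (r : ℝ) :
    Filter.Tendsto (fun t : ℕ => (⌊r * (p:ℝ) ^ t⌋ : ℝ) / (p:ℝ) ^ t) Filter.atTop (nhds r) := by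
  have hp1 : (1:ℝ) < p := by exact_mod_cast hp.one_lt
  have h0 : Filter.Tendsto (fun t : ℕ => ((p:ℝ)⁻¹) ^ t) Filter.atTop (nhds 0) :=
    tendsto_pow_atTop_nhds_zero_of_lt_one (by positivity) (inv_lt_one_of_one_lt₀ hp1)
  refine tendsto_of_tendsto_of_tendsto_of_le_of_le (g := fun t : ℕ => r - ((p:ℝ)⁻¹) ^ t)
    (h := fun _ => r) ?_ tendsto_const_nhds ?_ ?_
  · simpa using tendsto_const_nhds.sub h0
  · intro t
    have hpt : (0:ℝ) < (p:ℝ) ^ t := by positivity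
    simp only
    rw [le_div_iff₀ hpt, sub_mul, inv_pow, inv_mul_cancel₀ hpt.ne']
    exact (Int.sub_one_lt_floor _).le
  · intro t
    have hpt : (0:ℝ) < (p:ℝ) ^ t := by positivity
    simp only
    rw [div_le_iff₀ hpt]
    exact Int.floor_le _

lemma approx {p n k : ℕ} (hp : p.Prime) (mu : Fin n → ℝ) (r : Fin k → ℝ)
    (z : Fin k → Fin n → ℤ) :
    ∃ s : Fin k → ℝ, (∀ l, IsPadic p (s l)) ∧
      ∀ i, 0 < mu i + ∑ l, r l * (z l i : ℝ) → 0 < mu i + ∑ l, s l * (z l i : ℝ) := by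
  have : ∀ᶠ t : ℕ in Filter.atTop, ∀ i, 0 < mu i + ∑ l, r l * (z l i : ℝ) →
      0 < mu i + ∑ l, ((⌊r l * (p:ℝ) ^ t⌋ : ℝ) / (p:ℝ) ^ t) * (z l i : ℝ) := by
    rw [Filter.eventually_all]
    intro i
    by_cases h : 0 < mu i + ∑ l, r l * (z l i : ℝ)
    · have ht : Filter.Tendsto (fun t : ℕ =>
          mu i + ∑ l, ((⌊r l * (p:ℝ) ^ t⌋ : ℝ) / (p:ℝ) ^ t) * (z l i : ℝ)) Filter.atTop
          (nhds (mu i + ∑ l, r l * (z l i : ℝ))) :=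
        tendsto_const_nhds.add
          (tendsto_finsetSum _ fun l _ => (floor_tendsto hp (r l)).mul_const _)
      filter_upwards [ht.eventually (lt_mem_nhds h)] with t h1 _
      exact h1
    · exact Filter.Eventually.of_forall fun t h' => absurd h' h
  obtain ⟨t, ht⟩ := this.exists
  exact ⟨_, fun l => ⟨_, t, rfl⟩, ht⟩

lemma sum_sub {n : ℕ} (P : Fin n → Prop) [Fintype {i // P i}] (f : Fin n → ℝ)
    (hf : ∀ i, ¬ P i → f i = 0) : ∑ i : {i // P i}, f i.1 = ∑ i, f i := by
  classical
  refine Finset.sum_of_injOn Subtype.val Subtype.val_injective.injOn (by simp) ?_ (by simp)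
  intro i _ hi
  apply hf
  intro hP
  exact hi ⟨⟨i, hP⟩, by simp, rfl⟩

/-- A finite set of integral vectors is a `p`-adic generating set for a cone
iff, for every nonempty face `F` of its conic hull `C`, the vectors lying on `F` form a
`p`-adic generating set for a subspace. -/
theorem pGSC_iff_faces_pGSS {m n : ℕ} (p : ℕ) (hp : p.Prime) (a : Fin n → Fin m → ℤ) :
    IsPGSC p a ↔
      ∀ F : Set (Fin m → ℝ),
        IsFace {x | ∃ lam : Fin n → ℝ, (∀ i, 0 ≤ lam i) ∧
          ∀ j, x j = ∑ i, lam i * (a i j : ℝ)} F → F.Nonempty →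
        IsPGSS p (fun i : {i : Fin n // (fun j => (a i j : ℝ)) ∈ F} => a i.1) := by
  have hgen : ∀ i, (fun j => (a i j : ℝ)) ∈ {x : Fin m → ℝ | ∃ lam : Fin n → ℝ,
      (∀ i, 0 ≤ lam i) ∧ ∀ j, x j = ∑ i, lam i * (a i j : ℝ)} := by
    intro i
    refine ⟨fun k => if k = i then 1 else 0, fun k => ?_, fun j => ?_⟩
    · dsimp only
      split_ifs <;> norm_num
    · simp
  constructor
  · rintro hG F ⟨c, δ, hc, hFdef⟩ ⟨x, hxF⟩ w ⟨lam, hw⟩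
    obtain ⟨⟨lx, hlx, hx⟩, hxδ⟩ := hFdef ▸ hxF
    have hδ : δ = 0 := by
      apply le_antisymm
      · have := hc (fun j => 2 * x j) ⟨fun i => 2 * lx i, fun i => by linarith [hlx i], fun j => by
          simp only [hx, mul_assoc, ← Finset.mul_sum]⟩
        have h2 : ∑ j, c j * (2 * x j) = 2 * ∑ j, c j * x j := by
          rw [Finset.mul_sum]
          exact Finset.sum_congr rfl fun j _ => by ring
        linarith
      · have := hc 0 ⟨0, fun i => le_rfl, fun j => by simp⟩
        simpa using this
    subst hδ
    have hcle : ∀ i, ∑ j, c j * (a i j : ℝ) ≤ 0 := fun i => hc _ (hgen i)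
    let P : Fin n → Prop := fun i => (fun j => (a i j : ℝ)) ∈ F
    have hP : ∀ i, P i ↔ ∑ j, c j * (a i j : ℝ) = 0 := by
      intro i
      change (fun j => (a i j : ℝ)) ∈ F ↔ _
      rw [hFdef]
      exact ⟨fun h => h.2, fun h => ⟨hgen i, h⟩⟩
    change ∀ j, ∑ i : {i // P i}, lam i * (a i.1 j : ℝ) = (w j : ℝ) at hw
    let l' : Fin n → ℝ := fun i => if h : P i then lam ⟨i, h⟩ else 0
    have hl' : ∀ j, ∑ i, l' i * (a i j : ℝ) = w j := by
      intro j
      rw [← hw j, ← sum_sub P (fun i => l' i * (a i j : ℝ)) (fun i hi => by simp [l', hi])]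
      exact Finset.sum_congr rfl fun i _ => by simp [l', i.2]
    obtain ⟨N, hN⟩ : ∃ N : ℕ, ∀ i, |l' i| ≤ N := by
      obtain ⟨N, hN⟩ := exists_nat_ge (∑ i, |l' i|)
      exact ⟨N, fun i => (Finset.single_le_sum (f := fun i => |l' i|)
        (fun i _ => abs_nonneg _) (Finset.mem_univ i)).trans hN⟩
    let e : Fin n → ℤ := fun i => if P i then (N : ℤ) else 0
    have hw' : ∀ j, ∑ i, (l' i + e i) * (a i j : ℝ) = ((w j + ∑ i, e i * a i j : ℤ) : ℝ) := by
      intro j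
      simp only [add_mul, Finset.sum_add_distrib, hl']
      push_cast
      rfl
    obtain ⟨mu, hmu, hpad, hmuw⟩ := hG (fun j => w j + ∑ i, e i * a i j)
      ⟨fun i => l' i + e i, fun i => by
        by_cases h : P i
        · have := neg_le_of_abs_le (hN i)
          simp only [e, h, if_true]
          push_cast
          linarith
        · simp [l', e, h], hw'⟩
    have hzero : ∀ i, ¬ P i → mu i = 0 := by
      have h1 : ∑ i, mu i * ∑ j, c j * (a i j : ℝ) = 0 := by
        rw [← dot_comb (fun i j => (a i j : ℝ)) c mu]
        simp only [hmuw, ← hw']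
        rw [dot_comb (fun i j => (a i j : ℝ)) c]
        refine Finset.sum_eq_zero fun i _ => ?_
        by_cases h : P i
        · rw [(hP i).1 h, mul_zero]
        · simp [l', e, h]
      rw [Finset.sum_eq_zero_iff_of_nonpos
        (fun i _ => mul_nonpos_of_nonneg_of_nonpos (hmu i) (hcle i))] at h1
      intro i hi
      rcases mul_eq_zero.1 (h1 i (Finset.mem_univ _)) with h | h
      · exact h
      · exact absurd ((hP i).2 h) hi
    refine ⟨fun i => mu i.1 + ((-e i.1 : ℤ) : ℝ), fun i =>
      isPadic_add hp (hpad _) (isPadic_int p _), fun j => ?_⟩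
    refine (sum_sub P (fun i => (mu i + ((-e i : ℤ) : ℝ)) * (a i j : ℝ))
      (fun i hi => by simp [hzero i hi, e, hi])).trans ?_
    have := hmuw j
    push_cast at this ⊢
    simp only [add_mul, Finset.sum_add_distrib, this, neg_mul, Finset.sum_neg_distrib]
    ring
  · rintro hF w ⟨lam0, hlam0, hw0⟩
    obtain ⟨lam, c, hlam, hw, hc, hcw, hsc⟩ := compl_all (fun i j => (a i j : ℝ))
      (fun j => (w j : ℝ)) lam0 hlam0 (fun j => (hw0 j).symm)
    obtain ⟨F, hFdef⟩ : ∃ F : Set (Fin m → ℝ), F = {x ∈ {x : Fin m → ℝ | ∃ lam : Fin n → ℝ,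
        (∀ i, 0 ≤ lam i) ∧ ∀ j, x j = ∑ i, lam i * (a i j : ℝ)} | ∑ j, c j * x j = 0} := ⟨_, rfl⟩
    have hS := hF F ⟨c, 0, fun x ⟨l, hl, hx⟩ => by
        simp only [hx]
        rw [dot_comb (fun i j => (a i j : ℝ)) c]
        exact Finset.sum_nonpos fun k _ => mul_nonpos_of_nonneg_of_nonpos (hl k) (hc k), hFdef⟩
      ⟨fun j => (w j : ℝ), by
        rw [hFdef]
        exact ⟨⟨lam0, hlam0, fun j => (hw0 j).symm⟩, hcw⟩⟩
    let P : Fin n → Prop := fun i => (fun j => (a i j : ℝ)) ∈ F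
    have hP : ∀ i, P i ↔ ∑ j, c j * (a i j : ℝ) = 0 := by
      intro i
      change (fun j => (a i j : ℝ)) ∈ F ↔ _
      rw [hFdef]
      exact ⟨fun h => h.2, fun h => ⟨hgen i, h⟩⟩
    have hzero : ∀ i, ¬ P i → lam i = 0 := by
      have h1 : ∑ i, lam i * ∑ j, c j * (a i j : ℝ) = 0 := by
        rw [← dot_comb (fun i j => (a i j : ℝ)) c lam]
        simp only [← hw]
        exact hcw
      rw [Finset.sum_eq_zero_iff_of_nonpos
        (fun i _ => mul_nonpos_of_nonneg_of_nonpos (hlam i) (hc i))] at h1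
      intro i hi
      rcases mul_eq_zero.1 (h1 i (Finset.mem_univ _)) with h | h
      · exact h
      · exact absurd ((hP i).2 h) hi
    obtain ⟨mu, hpad, hmu⟩ := hS w ⟨fun i => lam i.1, fun j =>
      (sum_sub P (fun i => lam i * (a i j : ℝ)) (fun i hi => by simp [hzero i hi])).trans
        (hw j).symm⟩
    change ∀ j, ∑ i : {i // P i}, mu i * (a i.1 j : ℝ) = (w j : ℝ) at hmu
    let mu' : Fin n → ℝ := fun i => if h : P i then mu ⟨i, h⟩ else 0
    have hmu' : ∀ j, ∑ i, mu' i * (a i j : ℝ) = w j := by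
      intro j
      rw [← hmu j, ← sum_sub P (fun i => mu' i * (a i j : ℝ)) (fun i hi => by simp [mu', hi])]
      exact Finset.sum_congr rfl fun i _ => by simp [mu', i.2]
    have hpad' : ∀ i, IsPadic p (mu' i) := by
      intro i
      by_cases h : P i
      · simpa [mu', h] using hpad ⟨i, h⟩
      · simpa [mu', h] using isPadic_int p 0
    obtain ⟨k, r, z, hrz, hrel⟩ := int_decomp (fun i => lam i - mu' i)
    obtain ⟨s, hs, hspos⟩ := approx hp mu' r z
    have hker : ∀ j l, ∑ i, (z l i : ℝ) * (a i j : ℝ) = 0 := by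
      intro j l
      have := hrel (fun i => a i j) (by
        have h1 := hmu' j
        have h2 := hw j
        simp only [mul_sub, Finset.sum_sub_distrib]
        simp only [mul_comm (a _ j : ℝ)]
        linarith) l
      have h3 : ((∑ i, a i j * z l i : ℤ) : ℝ) = 0 := by exact_mod_cast this
      push_cast at h3
      rw [← h3]
      exact Finset.sum_congr rfl fun i _ => mul_comm _ _
    have hz : ∀ i, ¬ P i → ∀ l, z l i = 0 := by
      intro i hi l
      have := hrel (fun k => if k = i then 1 else 0) (by
        simp [hzero i hi, mu', hi]) l
      simpa using this
    refine ⟨fun i => mu' i + ∑ l, s l * (z l i : ℝ), fun i => ?_, fun i => ?_, fun j => ?_⟩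
    · by_cases h : P i
      · have hpos : 0 < lam i := by
          rcases hsc i with h' | h'
          · exact h'
          · exact absurd ((hP i).1 h) h'.ne
        refine (hspos i ?_).le
        rw [← hrz i]
        simpa using hpos
      · simp [mu', h, hz i h]
    · exact isPadic_add hp (hpad' i) (isPadic_sum hp _ _ fun l => isPadic_mul_int (hs l) _)
    · simp only [add_mul, Finset.sum_add_distrib, hmu', Finset.sum_mul]
      rw [Finset.sum_comm]
      simp only [mul_assoc, ← Finset.mul_sum, hker]
      simp
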